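/- arXiv:2211.07599 — 4 statements merged into one kernel-verified Lean document; each statement's English description precedes it below -/
import Mathlib

section
/- Let N ≥ 1 and n ≥ 1 be integers. Then ∫₀¹ (1−t)^n · t^N/(1−t^N) dt = −(1/N)·Σ_{m=0}^{n} C(n,m)(−1)^m ψ((m+1)/N) − 1/(n+1), where C(n,m) denotes the binomial coefficient. -/
open MeasureTheory Set

/-- The digamma function `ψ(x) = Γ'(x)/Γ(x)`. -/
noncomputable def digamma (x : ℝ) : ℝ := deriv Real.Gamma x / Real.Gamma x

open Filter Topology

lemma hasDerivAt_logGamma {x : ℝ} (hx : 0 < x) :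
    HasDerivAt (Real.log ∘ Real.Gamma) (digamma x) x := by
  have h1 : DifferentiableAt ℝ Real.Gamma x := by
    apply Real.differentiableAt_Gamma
    intro m
    have : (0:ℝ) ≤ m := Nat.cast_nonneg m
    linarith
  have := h1.hasDerivAt.log (Real.Gamma_pos_of_pos hx).ne'
  exact this

lemma logGamma_add_one {x : ℝ} (hx : 0 < x) :
    Real.log (Real.Gamma (x+1)) = Real.log x + Real.log (Real.Gamma x) := by
  rw [Real.Gamma_add_one hx.ne', Real.log_mul hx.ne' (Real.Gamma_pos_of_pos hx).ne']

lemma digamma_add_one {x : ℝ} (hx : 0 < x) : digamma (x+1) = digamma x + 1/x := by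
  have h1 : HasDerivAt (fun y => (Real.log ∘ Real.Gamma) (y+1)) (digamma (x+1)) x := by
    have := hasDerivAt_logGamma (x := x+1) (by linarith)
    exact this.comp_add_const x 1
  have h2 : HasDerivAt (fun y => Real.log y + (Real.log ∘ Real.Gamma) y) (x⁻¹ + digamma x) x :=
    (Real.hasDerivAt_log hx.ne').add (hasDerivAt_logGamma hx)
  have h3 : (fun y => (Real.log ∘ Real.Gamma) (y+1)) =ᶠ[𝓝 x]
      (fun y => Real.log y + (Real.log ∘ Real.Gamma) y) := by
    filter_upwards [lt_mem_nhds hx] with y hy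
    exact logGamma_add_one hy
  have := h1.unique (h2.congr_of_eventuallyEq h3)
  rw [this, one_div]; ring

lemma digamma_add_nat {x : ℝ} (hx : 0 < x) (K : ℕ) :
    digamma (x+K) = digamma x + ∑ k ∈ Finset.range K, 1/(x+k) := by
  induction K with
  | zero => simp
  | succ K ih =>
    rw [Finset.sum_range_succ, ← add_assoc, ← ih, Nat.cast_succ, ← add_assoc]
    exact digamma_add_one (by positivity)

lemma digamma_le {x : ℝ} (hx : 0 < x) : digamma x ≤ Real.log x := by
  have := Real.convexOn_log_Gamma.le_slope_of_hasDerivAt (x := x) (y := x+1) hx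
    (show (0:ℝ) < x+1 by linarith) (by linarith) (hasDerivAt_logGamma hx)
  rw [slope_def_field] at this
  simp only [Function.comp, logGamma_add_one hx] at this
  simpa using this

lemma le_digamma {x : ℝ} (hx : 0 < x) : Real.log x ≤ digamma (x+1) := by
  have := Real.convexOn_log_Gamma.slope_le_of_hasDerivAt (x := x) (y := x+1) hx
    (show (0:ℝ) < x+1 by linarith) (by linarith) (hasDerivAt_logGamma (by linarith))
  rw [slope_def_field] at this
  simp only [Function.comp, logGamma_add_one hx] at this
  simpa using this

lemma tendsto_log_sub (x : ℝ) :
    Tendsto (fun K : ℕ => Real.log (x+K) - Real.log K) atTop (𝓝 0) := by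
  have h : Tendsto (fun K : ℕ => x/(K:ℝ) + 1) atTop (𝓝 (0+1)) :=
    (tendsto_const_div_atTop_nhds_zero_nat x).add_const 1
  rw [zero_add] at h
  have h2 := h.log one_ne_zero
  rw [Real.log_one] at h2
  refine h2.congr' ?_
  filter_upwards [eventually_gt_atTop 0, 
    (tendsto_natCast_atTop_atTop (R := ℝ)).eventually_gt_atTop (-x)] with K hK hK2
  have : (0:ℝ) < K := by exact_mod_cast hK
  rw [← Real.log_div (by linarith) this.ne']
  congr 1
  field_simp

lemma tendsto_digamma {x : ℝ} (hx : 0 < x) :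
    Tendsto (fun K : ℕ => digamma (x+K) - Real.log K) atTop (𝓝 0) := by
  refine tendsto_of_tendsto_of_tendsto_of_le_of_le' (tendsto_log_sub (x-1)) (tendsto_log_sub x) ?_ ?_
  · filter_upwards [eventually_gt_atTop 0] with K hK
    have : (1:ℝ) ≤ K := by exact_mod_cast hK
    have := le_digamma (x := x - 1 + K) (by linarith)
    rw [show x - 1 + K + 1 = x + (K:ℝ) by ring] at this
    linarith
  · filter_upwards with K
    have := digamma_le (x := x + K) (by positivity)
    linarith

lemma tendsto_main (N n : ℕ) (hN : 1 ≤ N) (hn : 1 ≤ n) :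
    Tendsto (fun K : ℕ => ∫ t in Ioo (0:ℝ) 1, (1-t)^n * ∑ k ∈ Finset.range K, t^(N*(k+1))) atTop
     (𝓝 (∫ t in Ioo (0:ℝ) 1, (1-t)^n * (t^N / (1 - t^N)))) := by
  refine tendsto_integral_of_dominated_convergence (fun _ => (1:ℝ)) ?_ ?_ ?_ ?_
  · intro K
    exact (by fun_prop : Continuous _).aestronglyMeasurable
  · exact integrable_const _
  · intro K
    filter_upwards [ae_restrict_mem measurableSet_Ioo] with t ht
    obtain ⟨h0, h1⟩ := ht
    have hq : t^N ≤ t := pow_le_of_le_one h0.le h1.le (by omega)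
    have hs : 0 ≤ ∑ k ∈ Finset.range K, t^(N*(k+1)) := Finset.sum_nonneg fun _ _ => by positivity
    have hs2 : (1 - t^N) * ∑ k ∈ Finset.range K, t^(N*(k+1)) ≤ 1 := by
      have := mul_neg_geom_sum (t^N) K
      have e : ∑ k ∈ Finset.range K, t^(N*(k+1)) = t^N * ∑ k ∈ Finset.range K, (t^N)^k := by
        rw [Finset.mul_sum]; refine Finset.sum_congr rfl fun k _ => ?_
        rw [← pow_mul, ← pow_add]; ring_nf
      rw [e, mul_left_comm, this]
      have : 0 ≤ (t^N)^K := by positivity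
      have : 0 ≤ (t^N) := by positivity
      nlinarith
    have hp : (1-t)^n ≤ 1 - t := pow_le_of_le_one (by linarith) (by linarith) (by omega)
    have hp0 : 0 ≤ (1-t)^n := pow_nonneg (by linarith) _
    rw [Real.norm_of_nonneg (mul_nonneg hp0 hs)]
    refine le_trans (mul_le_mul_of_nonneg_right ?_ hs) hs2
    linarith
  · filter_upwards [ae_restrict_mem measurableSet_Ioo] with t ht
    obtain ⟨h0, h1⟩ := ht
    have := (hasSum_geometric_of_lt_one (r := t^N) (by positivity)
      (pow_lt_one₀ h0.le h1 (by omega))).tendsto_sum_nat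
    have := (this.const_mul (t^N)).const_mul ((1-t)^n)
    rw [← div_eq_mul_inv] at this
    refine this.congr fun K => ?_
    rw [Finset.mul_sum]; congr 1; refine Finset.sum_congr rfl fun k _ => ?_
    rw [← pow_mul, ← pow_add]; ring_nf

lemma integral_mono (j : ℕ) : ∫ t in Ioo (0:ℝ) 1, t^j = 1/(j+1) := by
  rw [← integral_Ioc_eq_integral_Ioo, ← intervalIntegral.integral_of_le zero_le_one, integral_pow]
  simp

lemma integral_one_sub (n : ℕ) : ∫ t in Ioo (0:ℝ) 1, (1-t)^n = 1/(n+1) := by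
  rw [← integral_Ioc_eq_integral_Ioo, ← intervalIntegral.integral_of_le zero_le_one,
    intervalIntegral.integral_comp_sub_left (fun t => t^n) 1, integral_pow]
  simp

lemma cont_int {f : ℝ → ℝ} (hf : Continuous f) : Integrable f (volume.restrict (Ioo (0:ℝ) 1)) :=
  (hf.integrableOn_Icc (a := 0) (b := 1)).mono_set Ioo_subset_Icc_self

lemma integral_beta (n j : ℕ) : ∫ t in Ioo (0:ℝ) 1, (1-t)^n * t^j =
    ∑ m ∈ Finset.range (n+1), (n.choose m : ℝ) * (-1)^m * (1/(j+m+1)) := by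
  have e : ∀ t : ℝ, (1-t)^n * t^j =
      ∑ m ∈ Finset.range (n+1), (n.choose m : ℝ) * (-1)^m * t^(j+m) := by
    intro t
    rw [sub_eq_neg_add, add_pow, Finset.sum_mul]
    refine Finset.sum_congr rfl fun m _ => ?_
    rw [neg_pow, pow_add]; ring
  simp_rw [e]
  rw [integral_finsetSum _ fun m _ => cont_int (by fun_prop)]
  refine Finset.sum_congr rfl fun m _ => ?_
  rw [integral_const_mul, integral_mono]
  push_cast; rfl

theorem integral_I1_formula (N n : ℕ) (hN : 1 ≤ N) (hn : 1 ≤ n) :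
    ∫ t in Ioo (0:ℝ) 1, (1-t)^n * (t^N / (1 - t^N)) =
      -(1/N) * ∑ m ∈ Finset.range (n+1),
          (n.choose m : ℝ) * (-1)^m * digamma ((m+1)/N)
        - 1/(n+1) := by
  have hN0 : (0:ℝ) < N := by exact_mod_cast hN
  have hx : ∀ m : ℕ, (0:ℝ) < (m+1)/N := fun m => by positivity
  have hc : ∑ m ∈ Finset.range (n+1), (n.choose m : ℝ) * (-1)^m = 0 := by
    have := Int.alternating_sum_range_choose_of_ne (n := n) (by omega)
    have h2 : ((∑ m ∈ Finset.range (n+1), ((-1)^m * n.choose m : ℤ) : ℤ) : ℝ) = 0 := by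
      rw [this]; simp
    push_cast at h2
    rw [← h2]
    exact Finset.sum_congr rfl fun m _ => mul_comm _ _
  refine tendsto_nhds_unique ((tendsto_main N n hN hn).comp (tendsto_add_atTop_nat 0)) ?_
  -- the limit of the tail
  have hz : Tendsto (fun K : ℕ => ∑ m ∈ Finset.range (n+1), (n.choose m : ℝ) * (-1)^m *
      (digamma ((m+1)/N + ((K+1 : ℕ) : ℝ)) - Real.log ((K+1 : ℕ) : ℝ))) atTop (𝓝 0) := by
    have := tendsto_finsetSum (Finset.range (n+1)) fun m _ =>
      (((tendsto_digamma (hx m)).comp (tendsto_add_atTop_nat 1)).const_mul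
        ((n.choose m : ℝ) * (-1)^m))
    simpa using this
  have hz2 := ((hz.const_mul (1/(N:ℝ))).const_add
    (-(1/N) * ∑ m ∈ Finset.range (n+1),
          (n.choose m : ℝ) * (-1)^m * digamma ((m+1)/N) - 1/(n+1)))
  rw [mul_zero, add_zero] at hz2
  refine hz2.congr fun K => ?_
  have hI : ∫ t in Ioo (0:ℝ) 1, (1-t)^n * ∑ k ∈ Finset.range K, t^(N*(k+1)) =
      (∑ k ∈ Finset.range (K+1), ∑ m ∈ Finset.range (n+1),
        (n.choose m : ℝ) * (-1)^m * (1/(((N*k : ℕ):ℝ)+m+1))) - 1/(n+1) := by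
    rw [Finset.sum_range_succ', ← integral_beta n (N*0)]
    simp only [mul_zero, pow_zero, mul_one, integral_one_sub, add_sub_cancel_right]
    simp_rw [Finset.mul_sum]
    rw [integral_finsetSum _ fun m _ => cont_int (by fun_prop)]
    exact Finset.sum_congr rfl fun k _ => integral_beta n _
  simp only [Function.comp, add_zero]
  rw [hI, Finset.sum_comm]
  simp_rw [mul_sub, Finset.sum_sub_distrib, ← Finset.sum_mul, hc, digamma_add_nat (hx _), mul_add,
    Finset.sum_add_distrib]
  have : ∀ m ∈ Finset.range (n+1), ∑ k ∈ Finset.range (K+1),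
        (n.choose m : ℝ) * (-1)^m * (1/(((N*k : ℕ):ℝ)+m+1)) = 1/N * ((n.choose m : ℝ) * (-1)^m *
          ∑ k ∈ Finset.range (K+1), 1/(((m:ℝ)+1)/N+k)) := by
    intro m _
    rw [Finset.mul_sum, Finset.mul_sum]
    refine Finset.sum_congr rfl fun k _ => ?_
    push_cast
    field_simp
    ring_nf
  rw [Finset.sum_congr rfl this, ← Finset.mul_sum]
  ring
end

section
/- Let N ≥ 2 be an integer. Then (N²/4) · ∫₀^∞ x^{-1}(1+x) Φ_N(x) dx = −(Nπ/4)·Σ_{j=1}^{N−1} (j/N)·cot(πj/N) + 3N²/8 − 3N/8. (This is the exact value of the expected Riesz 2-energy of the N zeros of a random elliptic polynomial mapped to the sphere by stereographic projection.) -/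
open MeasureTheory Set Real

/-- The 2-point intensity factor for zeros of degree-`N` random elliptic polynomials. -/
noncomputable def Phi (N : ℕ) (x : ℝ) : ℝ :=
  (((1+x)^N - 1 - N*x)^2 * (1+x)^(N-2) +
    ((1+x)^N - 1 - N*x*(1+x)^(N-1))^2) / ((1+x)^N - 1)^3

lemma sum_inv_aux (N : ℕ) (hN : 2 ≤ N) (u : ℝ) (hu : 1 < u) :
    ∑ j ∈ Finset.range N, ((u:ℂ) - Complex.exp (2*π*Complex.I/N)^j)⁻¹
      = N * (u:ℂ)^(N-1) / ((u:ℂ)^N - 1) := by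
  have hN0 : N ≠ 0 := by omega
  have hp := Complex.isPrimitiveRoot_exp N hN0
  set ζ := Complex.exp (2*π*Complex.I/N) with hζ
  have hA : (u:ℂ)^N - 1 ≠ 0 := by
    have : 1 < u^N := one_lt_pow₀ hu hN0
    have h : u^N - 1 ≠ 0 := by linarith
    exact_mod_cast h
  have h1 : ∀ j ∈ Finset.range N, ((u:ℂ) - ζ^j)⁻¹
      = (∑ k ∈ Finset.range N, (u:ℂ)^k * (ζ^j)^(N-1-k)) / ((u:ℂ)^N - 1) := by
    intro j _
    have h2 := geom_sum₂_mul (u:ℂ) (ζ^j) N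
    have h3 : (ζ^j)^N = 1 := by rw [← pow_mul, mul_comm, pow_mul, hp.pow_eq_one, one_pow]
    rw [h3] at h2
    have h4 : (u:ℂ) - ζ^j ≠ 0 := by
      intro h
      rw [h, mul_zero] at h2
      exact hA h2.symm
    rw [eq_div_iff hA, ← h2]
    field_simp
  rw [Finset.sum_congr rfl h1, ← Finset.sum_div, Finset.sum_comm]
  congr 1
  rw [Finset.sum_eq_single (N-1)]
  · simp
  · intro k hk hk'
    rw [Finset.mem_range] at hk
    rw [← Finset.mul_sum]
    have h5 : ∑ j ∈ Finset.range N, (ζ^j)^(N-1-k) = 0 := by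
      have h6 : ζ^(N-1-k) ≠ 1 := hp.pow_ne_one_of_pos_of_lt (by omega) (by omega)
      have h7 := mul_neg_geom_sum (ζ^(N-1-k)) N
      have h8 : (ζ^(N-1-k))^N = 1 := by rw [← pow_mul, mul_comm, pow_mul, hp.pow_eq_one, one_pow]
      rw [h8, sub_self] at h7
      have h9 := (mul_eq_zero.mp h7).resolve_left (sub_ne_zero.mpr h6.symm)
      rw [← h9]
      refine Finset.sum_congr rfl fun j _ => ?_
      rw [← pow_mul, ← pow_mul, mul_comm]
    rw [h5, mul_zero]
  · intro h
    exact absurd (Finset.mem_range.mpr (by omega)) h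

lemma D_pos (u t : ℝ) (hu : 1 < u) : 0 < u^2 - 2*u*cos t + 1 := by
  nlinarith [cos_le_one t, sq_nonneg (u-1), mul_nonneg (by linarith : (0:ℝ) ≤ u) (sub_nonneg.mpr (cos_le_one t)), mul_pos (sub_pos.mpr hu) (sub_pos.mpr hu)]

lemma sum_re (N : ℕ) (hN : 2 ≤ N) (u : ℝ) (hu : 1 < u) :
    ∑ j ∈ Finset.range N, (u - cos (2*π*j/N)) / (u^2 - 2*u*cos (2*π*j/N) + 1)
      = N * u^(N-1) / (u^N - 1) := by
  have h := congrArg Complex.re (sum_inv_aux N hN u hu)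
  have e : (N * (u:ℂ)^(N-1) / ((u:ℂ)^N - 1)) = ((N * u^(N-1) / (u^N - 1) : ℝ) : ℂ) := by
    push_cast; rfl
  rw [e, Complex.ofReal_re, Complex.re_sum] at h
  rw [← h]
  refine Finset.sum_congr rfl fun j _ => ?_
  have e2 : Complex.exp (2*π*Complex.I/N)^j = Complex.exp ((2*π*j/N : ℝ) * Complex.I) := by
    rw [← Complex.exp_nat_mul]; congr 1; push_cast; ring
  rw [e2, Complex.inv_re, Complex.normSq_apply, Complex.sub_re, Complex.sub_im,
    Complex.exp_ofReal_mul_I_re, Complex.exp_ofReal_mul_I_im, Complex.ofReal_re, Complex.ofReal_im]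
  congr 1
  nlinarith [sin_sq_add_cos_sq (2*π*j/N)]

lemma pf (N : ℕ) (hN : 2 ≤ N) (u : ℝ) (hu : 1 < u) :
    (u^(N-1) + 1) / ((u-1) * (u^N-1)) = 2 / (N * (u-1)^2) +
      (1/N) * ∑ j ∈ Finset.Icc 1 (N-1), (1 + cos (2*π*j/N)) / (u^2 - 2*u*cos (2*π*j/N) + 1) := by
  have hN0 : N ≠ 0 := by omega
  have hNr : (N:ℝ) ≠ 0 := by exact_mod_cast hN0
  have hA : u^N - 1 ≠ 0 := by
    have : 1 < u^N := one_lt_pow₀ hu hN0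
    linarith
  have hh : u - 1 ≠ 0 := by linarith
  have hs := sum_re N hN u hu
  have hu0 : u ≠ 0 := by linarith
  have hu1 : u + 1 ≠ 0 := by linarith
  have key : ∑ j ∈ Finset.range N, (1 + cos (2*π*j/N)) / (u^2 - 2*u*cos (2*π*j/N) + 1)
      = N * (u^(N-1) + 1) / ((u-1) * (u^N-1)) := by
    have e : ∀ j ∈ Finset.range N, (1 + cos (2*π*j/N)) / (u^2 - 2*u*cos (2*π*j/N) + 1)
        = ((u+1)/(u-1)) * ((u - cos (2*π*j/N)) / (u^2 - 2*u*cos (2*π*j/N) + 1)) - 1/(u-1) := by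
      intro j _
      have := (D_pos u (2*π*j/N) hu).ne'
      rw [div_mul_div_comm, div_sub_div _ _ (mul_ne_zero hh this) hh, div_eq_div_iff this (by positivity)]
      ring
    rw [Finset.sum_congr rfl e, Finset.sum_sub_distrib, ← Finset.mul_sum, hs]
    have e3 : u^N = u * u^(N-1) := by rw [← pow_succ']; congr 1; omega
    rw [e3] at hA ⊢
    simp only [Finset.sum_const, Finset.card_range, nsmul_eq_mul]
    clear e e3 hs
    generalize u^(N-1) = p at *
    field_simp
    ring
  have hr : Finset.range N = insert 0 (Finset.Icc 1 (N-1)) := by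
    ext j; simp; omega
  rw [hr, Finset.sum_insert (by simp)] at key
  simp only [Nat.cast_zero, mul_zero, zero_div, cos_zero, mul_one] at key
  have : u^2 - 2*u + 1 = (u-1)^2 := by ring
  rw [this] at key
  have k2 : ∑ j ∈ Finset.Icc 1 (N-1), (1 + cos (2*π*j/N)) / (u^2 - 2*u*cos (2*π*j/N) + 1) = N * (u^(N-1) + 1) / ((u-1) * (u^N-1)) - (1+1)/(u-1)^2 := by linarith
  rw [k2]
  field_simp
  ring

lemma integrand_eq (N : ℕ) (hN : 2 ≤ N) (x : ℝ) (hx : 0 < x) :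
    x⁻¹ * (1+x) * Phi N x =
      ((1+x)^(N-1)+(1+x))/(x*((1+x)^N-1)) - 2*N*((1+x)^(N-1)+(1+x)^N)/((1+x)^N-1)^2
        + N^2*x*((1+x)^(N-1)*(1 + (1+x)^N))/((1+x)^N-1)^3 := by
  have hA : (1+x)^N - 1 ≠ 0 := by
    have : 1 < (1+x)^N := one_lt_pow₀ (by linarith) (by omega)
    linarith
  have e2 : (1+x)^N = (1+x)^(N-2) * (1+x)^2 := by rw [← pow_add]; congr 1; omega
  have e1 : (1+x)^(N-1) = (1+x)^(N-2) * (1+x) := by rw [← pow_succ]; congr 1; omega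
  unfold Phi
  rw [e2] at hA
  rw [e1, e2]
  generalize (1+x)^(N-2) = q at *
  field_simp
  ring

noncomputable def Ratl (N : ℕ) (u : ℝ) : ℝ :=
  -(N * (u-1) * u^N/(u^N-1)^2) + (2+u)/(u^N-1) - 2/(N*(u-1))

noncomputable def Arcs (N : ℕ) (u : ℝ) : ℝ :=
  (1/N) * ∑ j ∈ Finset.Icc 1 (N-1), Real.cot (π * j / N) *
    (-arctan (sin (2*π*j/N) / (u - cos (2*π*j/N))))

lemma cot_mul_sin (t : ℝ) (ht : sin t ≠ 0) : Real.cot t * sin (2*t) = 1 + cos (2*t) := by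
  rw [Real.cot_eq_cos_div_sin, sin_two_mul, cos_two_mul]
  field_simp
  ring

lemma sin_ne (N j : ℕ) (hj : j ∈ Finset.Icc 1 (N-1)) : 0 < sin (π * j / N) := by
  rw [Finset.mem_Icc] at hj
  have hN : (0:ℝ) < N := by exact_mod_cast (by omega : 0 < N)
  have h1 : (0:ℝ) < j := by exact_mod_cast (by omega : 0 < j)
  have h2 : (j:ℝ) < N := by exact_mod_cast (by omega : j < N)
  apply sin_pos_of_pos_of_lt_pi
  · positivity
  · rw [div_lt_iff₀ hN]
    exact mul_lt_mul_of_pos_left h2 pi_pos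

lemma Arcs_deriv (N : ℕ) (u : ℝ) (hu : 1 < u) :
    HasDerivAt (Arcs N) ((1/N) * ∑ j ∈ Finset.Icc 1 (N-1),
      (1 + cos (2*π*j/N)) / (u^2 - 2*u*cos (2*π*j/N) + 1)) u := by
  unfold Arcs
  refine HasDerivAt.const_mul _ ?_
  refine HasDerivAt.fun_sum fun j hj => ?_
  have hs := sin_ne N j hj
  have e : 2*π*j/N = 2*(π*j/N) := by ring
  rw [e]
  rw [← cot_mul_sin _ hs.ne']
  set t := 2*(π*j/N)
  have hv : u - cos t ≠ 0 := by linarith [cos_le_one t]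
  have hD := (D_pos u t hu).ne'
  have h1 : HasDerivAt (fun u => sin t / (u - cos t)) ((0 * (u - cos t) - sin t * 1)/(u - cos t)^2) u :=
    (hasDerivAt_const u (sin t)).fun_div ((hasDerivAt_id' u).sub_const (cos t)) hv
  refine (h1.arctan.fun_neg.const_mul (Real.cot (π*j/N))).congr_deriv ?_
  have e3 : u^2 - 2*u*cos t + 1 = (u - cos t)^2 + sin t^2 := by
    nlinarith [sin_sq_add_cos_sq t]
  rw [e3] at hD ⊢
  have : 1 + (sin t / (u - cos t))^2 = ((u - cos t)^2 + sin t^2)/(u - cos t)^2 := by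
    field_simp
  rw [this]
  field_simp
  ring

lemma Arcs_tendsto (N : ℕ) : Filter.Tendsto (Arcs N) Filter.atTop (nhds 0) := by
  have : (0:ℝ) = (1/N) * ∑ j ∈ Finset.Icc 1 (N-1), Real.cot (π * j / N) * (-arctan 0) := by simp
  rw [this]
  unfold Arcs
  refine Filter.Tendsto.const_mul _ ?_
  refine tendsto_finsetSum _ fun j hj => ?_
  refine Filter.Tendsto.const_mul _ ?_
  refine Filter.Tendsto.neg ?_
  refine (continuous_arctan.tendsto 0).comp ?_
  exact Filter.Tendsto.const_div_atTop (Filter.tendsto_atTop_add_const_right _ _ Filter.tendsto_id) _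

lemma Arcs_cont (N : ℕ) : ContinuousAt (Arcs N) 1 := by
  unfold Arcs
  refine ContinuousAt.mul continuousAt_const ?_
  refine tendsto_finsetSum _ fun j hj => ?_
  have hs := sin_ne N j hj
  have hv : (1:ℝ) - cos (2*π*j/N) ≠ 0 := by
    have e : 2*π*j/N = 2*(π*j/N) := by ring
    rw [e, cos_two_mul]
    nlinarith [sin_sq_add_cos_sq (π*j/N)]
  have h : ContinuousAt (fun u : ℝ => Real.cot (π * j / N) *
    (-arctan (sin (2*π*j/N) / (u - cos (2*π*j/N))))) 1 := by
    refine ContinuousAt.mul continuousAt_const ?_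
    refine ContinuousAt.neg ?_
    refine continuous_arctan.continuousAt.comp ?_
    refine ContinuousAt.div continuousAt_const (by fun_prop) hv
  exact h

lemma cot_sum (N : ℕ) : ∑ j ∈ Finset.Icc 1 (N-1), Real.cot (π * j / N) = 0 := by
  have h : ∑ j ∈ Finset.Icc 1 (N-1), Real.cot (π * j / N)
      = ∑ j ∈ Finset.Icc 1 (N-1), -Real.cot (π * j / N) := by
    refine Finset.sum_nbij' (fun j => N - j) (fun j => N - j) ?_ ?_ ?_ ?_ ?_
    · intro j hj; simp at hj ⊢; omega
    · intro j hj; simp at hj ⊢; omega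
    · intro j hj; simp at hj ⊢; omega
    · intro j hj; simp at hj ⊢; omega
    · intro j hj
      simp only [Finset.mem_Icc] at hj
      have hN : (N:ℝ) ≠ 0 := by exact_mod_cast (by omega : N ≠ 0)
      rw [Nat.cast_sub (by omega)]
      have : π * ((N:ℝ) - j) / N = π - π*j/N := by field_simp
      rw [this, Real.cot_eq_cos_div_sin, Real.cot_eq_cos_div_sin, sin_pi_sub, cos_pi_sub]
      ring
  rw [Finset.sum_neg_distrib] at h
  linarith

lemma Arcs_one (N : ℕ) : Arcs N 1 = (π/N) * ∑ j ∈ Finset.Icc 1 (N-1), ((j:ℝ)/N) * Real.cot (π * j / N) := by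
  have h : ∀ j ∈ Finset.Icc 1 (N-1), Real.cot (π * j / N) *
    (-arctan (sin (2*π*j/N) / (1 - cos (2*π*j/N)))) = π * (((j:ℝ)/N) * Real.cot (π * j / N)) - π/2 * Real.cot (π * j / N) := by
    intro j hj
    have hs := sin_ne N j hj
    have e : 2*π*j/N = 2*(π*j/N) := by ring
    have e2 : sin (2*π*j/N) / (1 - cos (2*π*j/N)) = tan (π/2 - π*j/N) := by
      rw [tan_pi_div_two_sub, tan_eq_sin_div_cos, inv_div, e, sin_two_mul, cos_two_mul]
      have : 1 - (2*cos (π*j/N)^2 - 1) = 2 * sin (π*j/N)^2 := by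
        nlinarith [sin_sq_add_cos_sq (π*j/N)]
      rw [this]
      field_simp
    rw [Finset.mem_Icc] at hj
    have hN : (0:ℝ) < N := by exact_mod_cast (by omega : 0 < N)
    have h1 : (0:ℝ) < j := by exact_mod_cast (by omega : 0 < j)
    have h2 : (j:ℝ) < N := by exact_mod_cast (by omega : j < N)
    have h3 : 0 < π*j/N := by positivity
    have h4 : π*j/N < π := by
      rw [div_lt_iff₀ hN]
      exact mul_lt_mul_of_pos_left h2 pi_pos
    rw [e2, arctan_tan (by linarith) (by linarith)]
    ring
  unfold Arcs
  rw [Finset.sum_congr rfl h, Finset.sum_sub_distrib, ← Finset.mul_sum, ← Finset.mul_sum, cot_sum]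
  ring

lemma Ratl_deriv (N : ℕ) (hN : 2 ≤ N) (u : ℝ) (hu : 1 < u) :
    HasDerivAt (Ratl N) ((u^(N-1)+u)/((u-1)*(u^N-1)) - 2*N*(u^(N-1)+u^N)/(u^N-1)^2
        + N^2*(u-1)*(u^(N-1)*(1 + u^N))/(u^N-1)^3 - ((u^(N-1) + 1) / ((u-1) * (u^N-1)) - 2 / (N * (u-1)^2))) u := by
  have hA : u^N - 1 ≠ 0 := by
    have : 1 < u^N := one_lt_pow₀ hu (by omega)
    linarith
  have hh : u - 1 ≠ 0 := by linarith
  have hNr : (N:ℝ) ≠ 0 := by exact_mod_cast (by omega : N ≠ 0)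
  have d1 : HasDerivAt (fun u : ℝ => u^N) (N*u^(N-1)) u := hasDerivAt_pow N u
  have d2 : HasDerivAt (fun u : ℝ => u - 1) 1 u := (hasDerivAt_id' u).sub_const 1
  have d3 := d1.sub_const 1
  have t1 := (((d2.const_mul (N:ℝ)).fun_mul d1).fun_div (d3.fun_pow 2) (pow_ne_zero 2 hA)).fun_neg
  have t2 := ((hasDerivAt_id' u).const_add 2).fun_div d3 hA
  have t3 := (hasDerivAt_const u (2:ℝ)).fun_div (d2.const_mul (N:ℝ)) (mul_ne_zero hNr hh)
  unfold Ratl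
  refine ((t1.fun_add t2).fun_sub t3).congr_deriv ?_
  have e1 : u^N = u^(N-1) * u := by rw [← pow_succ]; congr 1; omega
  rw [e1] at hA ⊢
  clear t1 t2 t3 d1 d2 d3 e1
  generalize u^(N-1) = q at *
  field_simp
  ring

noncomputable def Sg (N : ℕ) (u : ℝ) : ℝ := ∑ k ∈ Finset.range N, u^k
noncomputable def Pg (N : ℕ) (u : ℝ) : ℝ := -(N^2 * u^N) + N*(2+u)*Sg N u - 2*(Sg N u)^2

lemma Sg_deriv (N : ℕ) : HasDerivAt (Sg N) ((N:ℝ)*(N-1)/2) 1 := by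
  have h : HasDerivAt (Sg N) (∑ k ∈ Finset.range N, (k:ℝ) * 1^(k-1)) 1 := by
    unfold Sg
    exact HasDerivAt.fun_sum fun k _ => hasDerivAt_pow k 1
  refine h.congr_deriv ?_
  simp only [one_pow, mul_one]
  induction N with
  | zero => simp
  | succ n ih => 
    rw [Finset.sum_range_succ, ih]
    · push_cast; ring
    · unfold Sg
      exact HasDerivAt.fun_sum fun k _ => hasDerivAt_pow k 1

lemma Sg_one (N : ℕ) : Sg N 1 = N := by simp [Sg]

lemma Pg_deriv (N : ℕ) : HasDerivAt (Pg N) (-(N:ℝ)^3 + N^2 - N*(N*(N-1)/2)) 1 := by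
  have s := Sg_deriv N
  have d1 : HasDerivAt (fun u : ℝ => u^N) (N*1^(N-1)) 1 := hasDerivAt_pow N 1
  have t1 := (d1.const_mul ((N:ℝ)^2)).fun_neg
  have t2 := (((hasDerivAt_id' (1:ℝ)).const_add 2).const_mul (N:ℝ)).fun_mul s
  have t3 := (s.fun_pow 2).const_mul 2
  unfold Pg
  refine ((t1.fun_add t2).fun_sub t3).congr_deriv ?_
  rw [Sg_one]
  simp only [one_pow]
  push_cast
  ring

noncomputable def Rc (N : ℕ) (u : ℝ) : ℝ := dslope (Pg N) 1 u / (N * (Sg N u)^2)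

lemma Sg_mul (N : ℕ) (u : ℝ) : Sg N u * (u-1) = u^N - 1 := by
  have := geom_sum_mul u N
  exact this

lemma Rc_eq (N : ℕ) (hN : 2 ≤ N) (u : ℝ) (hu : 1 < u) : Rc N u = Ratl N u := by
  have hA : u^N - 1 ≠ 0 := by
    have : 1 < u^N := one_lt_pow₀ hu (by omega)
    linarith
  have hh : u - 1 ≠ 0 := by linarith
  have hNr : (N:ℝ) ≠ 0 := by exact_mod_cast (by omega : N ≠ 0)
  unfold Rc Ratl
  rw [dslope_of_ne _ hu.ne', slope_def_field]
  have hP : Pg N 1 = 0 := by simp [Pg, Sg_one]; ring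
  rw [hP, sub_zero]
  unfold Pg
  have m := Sg_mul N u
  rw [← m] at hA ⊢
  have e : u^N = Sg N u * (u-1) + 1 := by linarith
  rw [e]
  have hS : Sg N u ≠ 0 := left_ne_zero_of_mul hA
  field_simp

lemma Rc_one (N : ℕ) (hN : 2 ≤ N) : Rc N 1 = -(3*((N:ℝ)-1)/(2*N)) := by
  have hNr : (N:ℝ) ≠ 0 := by exact_mod_cast (by omega : N ≠ 0)
  unfold Rc
  rw [dslope_same, (Pg_deriv N).deriv, Sg_one]
  field_simp
  ring

lemma Rc_cont (N : ℕ) (hN : 2 ≤ N) : ContinuousAt (Rc N) 1 := by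
  have hNr : (N:ℝ) ≠ 0 := by exact_mod_cast (by omega : N ≠ 0)
  unfold Rc
  refine ContinuousAt.div ?_ ?_ ?_
  · exact continuousAt_dslope_same.mpr (Pg_deriv N).differentiableAt
  · exact continuousAt_const.mul ((Sg_deriv N).continuousAt.pow 2)
  · rw [Sg_one]; positivity

lemma Ratl_tendsto (N : ℕ) (hN : 2 ≤ N) : Filter.Tendsto (Ratl N) Filter.atTop (nhds 0) := by
  have hNr : (N:ℝ) ≠ 0 := by exact_mod_cast (by omega : N ≠ 0)
  have hh : Filter.Tendsto (fun u : ℝ => u - 1) Filter.atTop Filter.atTop :=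
    Filter.tendsto_atTop_add_const_right _ _ Filter.tendsto_id
  have hA : Filter.Tendsto (fun u : ℝ => u^N - 1) Filter.atTop Filter.atTop :=
    Filter.tendsto_atTop_add_const_right _ _ (Filter.tendsto_pow_atTop (by omega))
  have hS : Filter.Tendsto (Sg N) Filter.atTop Filter.atTop := by
    refine Filter.tendsto_atTop_mono' _ ?_ Filter.tendsto_id
    filter_upwards [Filter.eventually_gt_atTop 1] with u hu
    have : ∀ k ∈ Finset.range N, 0 ≤ u^k := fun k _ => by positivity
    have h := Finset.single_le_sum this (Finset.mem_range.mpr (by omega : 1 < N))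
    simpa [Sg] using h
  have a := hA.inv_tendsto_atTop
  have s := hS.inv_tendsto_atTop
  have h := hh.inv_tendsto_atTop
  have key := (((s.mul (a.const_add 1)).const_mul (-(N:ℝ))).add ((a.const_mul 3).add s)).sub (h.const_mul (2/(N:ℝ)))
  have z : -(N:ℝ) * (0 * (1+0)) + (3*0+0) - 2/(N:ℝ)*0 = 0 := by ring
  rw [z] at key
  refine key.congr' ?_
  filter_upwards [Filter.eventually_gt_atTop 1] with u hu
  have hA : u^N - 1 ≠ 0 := by
    have : 1 < u^N := one_lt_pow₀ hu (by omega)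
    linarith
  have hh : u - 1 ≠ 0 := by linarith
  simp only [Pi.inv_apply]
  unfold Ratl
  have m := Sg_mul N u
  rw [← m] at hA ⊢
  have e : u^N = Sg N u * (u-1) + 1 := by linarith
  rw [e]
  have hS : Sg N u ≠ 0 := left_ne_zero_of_mul hA
  field_simp
  ring

/-- Exact value of the expected Riesz `2`-energy of the zeros of a random elliptic
polynomial mapped to the sphere. -/
theorem expected_riesz_two_energy (N : ℕ) (hN : 2 ≤ N) :
    (N:ℝ)^2/4 * ∫ x in Ioi (0:ℝ), x⁻¹ * (1+x) * Phi N x =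
      -((N:ℝ) * π / 4) * ∑ j ∈ Finset.Icc 1 (N-1), ((j:ℝ)/N) * Real.cot (π * j / N)
      + 3*(N:ℝ)^2/8 - 3*(N:ℝ)/8 := by
  have hNr : (N:ℝ) ≠ 0 := by exact_mod_cast (by omega : N ≠ 0)
  have main : ∫ x in Ioi (0:ℝ), x⁻¹ * (1+x) * Phi N x
      = 0 - (Rc N (1+0) + Arcs N (1+0)) := by
    refine integral_Ioi_of_hasDerivAt_of_nonneg (g := fun x => Rc N (1+x) + Arcs N (1+x)) ?_ ?_ ?_ ?_
    · refine ContinuousAt.continuousWithinAt ?_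
      have h1 : ContinuousAt (fun u => Rc N u + Arcs N u) (1+0) := by
        rw [add_zero]
        exact (Rc_cont N hN).add (Arcs_cont N)
      exact h1.comp (f := fun x : ℝ => 1 + x) (by fun_prop)
    · intro x hx
      have hx : 0 < x := hx
      have hu : 1 < 1 + x := by linarith
      have r : HasDerivAt (Rc N) _ (1+x) := (Ratl_deriv N hN (1+x) hu).congr_of_eventuallyEq (by
        filter_upwards [lt_mem_nhds hu] with u hu
        exact Rc_eq N hN u hu)
      refine ((r.comp_const_add 1 x).fun_add ((Arcs_deriv N (1+x) hu).comp_const_add 1 x)).congr_deriv ?_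
      rw [integrand_eq N hN x hx, pf N hN (1+x) hu]
      have : 1 + x - 1 = x := by ring
      rw [this]
      ring
    · intro x hx
      have hx : 0 < x := hx
      have : 0 < (1+x)^N - 1 := by
        have : 1 < (1+x)^N := one_lt_pow₀ (by linarith) (by omega)
        linarith
      unfold Phi
      positivity
    · have h : Filter.Tendsto (fun u => Rc N u + Arcs N u) Filter.atTop (nhds (0+0)) := by
        refine Filter.Tendsto.add ?_ (Arcs_tendsto N)
        refine (Ratl_tendsto N hN).congr' ?_
        filter_upwards [Filter.eventually_gt_atTop 1] with u hu
        exact (Rc_eq N hN u hu).symm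
      rw [add_zero] at h
      exact h.comp (Filter.tendsto_atTop_add_const_left _ 1 Filter.tendsto_id)
  rw [main, add_zero, Rc_one N hN, Arcs_one]
  field_simp
  ring
end

section
/- Let N ≥ 2 be an integer. Then −2N² · ∫₀^∞ r·log( 2r/√(1+r²) )·Φ_N(r²) dr = (1/2 − log 2)N² − (N log N)/2 − (1/2 − log 2)N. (This is the exact value of the expected logarithmic energy of the N zeros of a random elliptic polynomial mapped to the sphere by stereographic projection, recovering the formula of Armentano, Beltrán and Shub.) -/
open MeasureTheory Set Real

open Filter Topology

noncomputable def geoA (N : ℕ) (x : ℝ) : ℝ := ∑ i ∈ Finset.range N, (1+x)^i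

noncomputable def fnK (N : ℕ) (x : ℝ) : ℝ :=
  x/(1+x) + 1/((1+x) * geoA N x) + 1/geoA N x - N * (1+x)^(N-1) / (geoA N x)^2

noncomputable def fnP (N : ℕ) (x : ℝ) : ℝ :=
  Real.log x * (fnK N x - 1/N) - fnK N x * Real.log (1+x) + 1/(1+x)
    - (1/N) * Real.log (geoA N x) + Real.log (1+x) - 1/((1+x) * geoA N x)

lemma geoA_mul (N : ℕ) (x : ℝ) : x * geoA N x = (1+x)^N - 1 := by
  have := mul_geom_sum (1+x) N
  simpa [geoA] using this

lemma geoA_ge (N : ℕ) (hN : 2 ≤ N) (x : ℝ) (hx : 0 ≤ x) : 1 + x ≤ geoA N x := by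
  have h : (1+x)^1 ≤ geoA N x :=
    Finset.single_le_sum (f := fun i => (1+x)^i) (fun i _ => by positivity)
      (Finset.mem_range.2 (by omega))
  simpa using h

lemma geoA_zero (N : ℕ) : geoA N 0 = N := by simp [geoA]

lemma geoA_diff (N : ℕ) : Differentiable ℝ (geoA N) := by
  unfold geoA; fun_prop

lemma fnK_zero (N : ℕ) (hN : 2 ≤ N) : fnK N 0 = 1/N := by
  have : (N:ℝ) ≠ 0 := by positivity
  simp [fnK, geoA_zero]; field_simp; ring

lemma fnK_diff (N : ℕ) (hN : 2 ≤ N) (x : ℝ) (hx : 0 ≤ x) : DifferentiableAt ℝ (fnK N) x := by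
  have hA := geoA_ge N hN x hx
  have h1 : 1 + x ≠ 0 := by positivity
  have h2 : geoA N x ≠ 0 := by linarith
  have h3 := geoA_diff N x
  unfold fnK
  fun_prop (disch := first | assumption | positivity)

/-- `fnK` for positive argument. -/
lemma fnK_eq (N : ℕ) (x : ℝ) (hx : 0 < x) :
    fnK N x = x/(1+x) + x/((1+x) * ((1+x)^N-1)) + x/((1+x)^N-1)
      - N * x^2 * (1+x)^(N-1) / ((1+x)^N-1)^2 := by
  have hx' := hx.ne'
  rw [← geoA_mul, fnK]
  by_cases h : geoA N x = 0
  · simp [h]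
  · field_simp

lemma pow_gt (N : ℕ) (hN : 2 ≤ N) (x : ℝ) (hx : 0 < x) : 0 < (1+x)^N - 1 := by
  have := one_lt_pow₀ (by linarith : 1 < 1 + x) (by omega : N ≠ 0)
  linarith

lemma fnK_deriv (N : ℕ) (hN : 2 ≤ N) (x : ℝ) (hx : 0 < x) : HasDerivAt (fnK N) (Phi N x) x := by
  have hs := (pow_gt N hN x hx).ne'
  have hu : 1 + x ≠ 0 := by positivity
  obtain ⟨M, rfl⟩ : ∃ M, N = M + 2 := ⟨N - 2, by omega⟩
  have hd (n : ℕ) : HasDerivAt (fun y : ℝ => (1+y)^n) (n * (1+x)^(n-1)) x := by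
    simpa using ((hasDerivAt_id x).const_add 1).fun_pow n
  have hdu : HasDerivAt (fun y : ℝ => 1+y) 1 x := (hasDerivAt_id x).const_add 1
  have hds := (hd (M+2)).sub_const 1
  have hid := hasDerivAt_id x
  have key := (((hid.div hdu hu).add (hid.div (hdu.mul hds) (mul_ne_zero hu hs))).add
    (hid.div hds hs)).sub
    ((((hid.pow 2).const_mul (((M+2 : ℕ):ℝ))).mul (hd (M+2-1))).div (hds.pow 2) (pow_ne_zero 2 hs))
  refine HasDerivAt.congr_of_eventuallyEq (key.congr_deriv ?_) ?_
  · simp only [Phi, Pi.mul_apply, Pi.pow_apply, id]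
    simp only [show M + 2 - 1 = M + 1 by omega, show M + 1 - 1 = M by omega, show M + 2 - 2 = M by omega] at hs ⊢
    rw [pow_succ _ (M+1), pow_succ _ M] at *
    generalize (1+x)^M = w at *
    clear key hds hd hdu hid
    push_cast
    obtain ⟨u, rfl⟩ : ∃ u, x = u - 1 := ⟨1 + x, by ring⟩
    simp only [show 1 + (u - 1) = u by ring] at *
    have hs1 : w * u^2 - 1 ≠ 0 := by convert hs using 2; ring
    have hs2 : u^2 * w - 1 ≠ 0 := by convert hs using 2; ring
    field_simp
    ring
  · filter_upwards [lt_mem_nhds hx] with y hy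
    simp [fnK_eq _ y hy]

lemma fnP_eq (N : ℕ) (hN : 2 ≤ N) (x : ℝ) (hx : 0 < x) :
    fnP N x = (Real.log x - Real.log (1+x)) * fnK N x + 1/(1+x)
      - (1/N) * (Real.log ((1+x)^N - 1) - N * Real.log (1+x)) - x/((1+x)*((1+x)^N-1)) := by
  have hA := geoA_ge N hN x hx.le
  have h2 : geoA N x ≠ 0 := by linarith
  have hN' : (N:ℝ) ≠ 0 := by positivity
  rw [← geoA_mul, Real.log_mul hx.ne' h2, fnP]
  have : x / ((1+x) * (x * geoA N x)) = 1/((1+x) * geoA N x) := by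
    field_simp
  rw [this]
  field_simp
  ring

lemma fnP_deriv (N : ℕ) (hN : 2 ≤ N) (x : ℝ) (hx : 0 < x) :
    HasDerivAt (fnP N) ((Real.log x - Real.log (1+x)) * Phi N x) x := by
  have hs := (pow_gt N hN x hx).ne'
  have hu : 1 + x ≠ 0 := by positivity
  have hN' : (N:ℝ) ≠ 0 := by positivity
  have hd : HasDerivAt (fun y : ℝ => (1+y)^N) (N * (1+x)^(N-1)) x := by
    simpa using ((hasDerivAt_id x).const_add 1).fun_pow N
  have hdu : HasDerivAt (fun y : ℝ => 1+y) 1 x := (hasDerivAt_id x).const_add 1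
  have hds := hd.sub_const 1
  have hid := hasDerivAt_id x
  have key := (((((hid.log hx.ne').sub (hdu.log hu)).mul (fnK_deriv N hN x hx)).add
    ((hasDerivAt_const x (1:ℝ)).div hdu hu)).sub
    (((hds.log hs).sub ((hdu.log hu).const_mul (N:ℝ))).const_mul (1/(N:ℝ)))).sub
    (hid.div (hdu.mul hds) (mul_ne_zero hu hs))
  refine HasDerivAt.congr_of_eventuallyEq (key.congr_deriv ?_) ?_
  · simp only [Pi.mul_apply, Pi.sub_apply, id]
    rw [add_sub_assoc, add_sub_assoc, add_comm, ← sub_eq_zero]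
    rw [fnK_eq N x hx]
    generalize Phi N x = p
    generalize Real.log x = l1
    generalize Real.log (1+x) = l2
    obtain ⟨M, rfl⟩ : ∃ M, N = M + 1 := ⟨N - 1, by omega⟩
    simp only [show M + 1 - 1 = M by omega] at hs ⊢
    rw [pow_succ _ M] at *
    generalize (1+x)^M = w at *
    generalize ((M+1 : ℕ):ℝ) = n at *
    obtain ⟨u, rfl⟩ : ∃ u, x = u - 1 := ⟨1 + x, by ring⟩
    have hx0 : u - 1 ≠ 0 := hx.ne'
    simp only [show 1 + (u - 1) = u by ring] at *
    have hs1 : u * w - 1 ≠ 0 := by rwa [mul_comm]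
    field_simp
    ring
  · filter_upwards [lt_mem_nhds hx] with y hy
    simp [fnP_eq N hN y hy]

lemma fnP_zero (N : ℕ) : fnP N 0 = 1 - Real.log N / N - 1/N := by
  simp [fnP, geoA_zero]; ring

lemma fnP_cont (N : ℕ) (hN : 2 ≤ N) : ContinuousAt (fnP N) 0 := by
  have hN' : (N:ℝ) ≠ 0 := by positivity
  have hK := fnK_diff N hN 0 le_rfl
  have h3 := (geoA_diff N 0).continuousAt
  have hA0 : geoA N 0 ≠ 0 := by rw [geoA_zero]; exact hN'
  have h1 : ContinuousAt (fun x => Real.log x * (fnK N x - 1/N)) 0 := by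
    have hO : (fun x => fnK N x - 1/N) =O[𝓝 0] (fun x : ℝ => x) := by
      have := hK.hasFDerivAt.isBigO_sub
      simpa [fnK_zero N hN] using this
    have hl : Tendsto (fun x : ℝ => Real.log x * x) (𝓝 0) (𝓝 0) := by
      have := Real.continuous_mul_log.tendsto 0
      simpa [mul_comm] using this
    have := ((Asymptotics.isBigO_refl Real.log (𝓝 0)).mul hO).trans_tendsto hl
    simpa [ContinuousAt] using this
  have hKc := hK.continuousAt
  have hl : ContinuousAt (fun x : ℝ => Real.log (1+x)) 0 :=
    ContinuousAt.log (by fun_prop) (by norm_num)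
  have hlA : ContinuousAt (fun x : ℝ => Real.log (geoA N x)) 0 := h3.log hA0
  have hi : ContinuousAt (fun x : ℝ => 1/(1+x)) 0 :=
    ContinuousAt.div (by fun_prop) (by fun_prop) (by norm_num)
  have hj : ContinuousAt (fun x : ℝ => 1/((1+x) * geoA N x)) 0 :=
    ContinuousAt.div (by fun_prop) (by fun_prop) (by simpa using hA0)
  unfold fnP
  exact ((((h1.sub (hKc.mul hl)).add hi).sub (hlA.const_mul _)).add hl).sub hj

lemma tend_u : Tendsto (fun x : ℝ => 1 + x) atTop atTop := tendsto_atTop_add_const_left _ _ tendsto_id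

lemma tend_A (N : ℕ) (hN : 2 ≤ N) : Tendsto (geoA N) atTop atTop :=
  tendsto_atTop_mono' _ (by
    filter_upwards [eventually_ge_atTop 0] with x hx using geoA_ge N hN x hx) tend_u

lemma tend_xu : Tendsto (fun x : ℝ => x/(1+x)) atTop (𝓝 1) := by
  have : Tendsto (fun x : ℝ => 1 - (1+x)⁻¹) atTop (𝓝 (1 - 0)) :=
    tendsto_const_nhds.sub (tendsto_inv_atTop_zero.comp tend_u)
  rw [sub_zero] at this
  refine this.congr' ?_
  filter_upwards [eventually_gt_atTop 0] with x hx
  field_simp; ring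

lemma fnK_lim (N : ℕ) (hN : 2 ≤ N) : Tendsto (fnK N) atTop (𝓝 1) := by
  have hu := tendsto_inv_atTop_zero.comp tend_u
  have hA := tendsto_inv_atTop_zero.comp (tend_A N hN)
  have h : Tendsto (fun x : ℝ => x/(1+x) + (1+x)⁻¹ * (geoA N x)⁻¹ + (geoA N x)⁻¹
      - N * ((1+x)⁻¹ * (geoA N x)⁻¹ * (geoA N x)⁻¹ + x/(1+x) * (geoA N x)⁻¹)) atTop
      (𝓝 (1 + 0 * 0 + 0 - N * (0*0*0 + 1 * 0))) :=
    ((tend_xu.add (hu.mul hA)).add hA).sub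
      ((((hu.mul hA).mul hA).add (tend_xu.mul hA)).const_mul _)
  simp only [mul_zero, zero_mul, add_zero, sub_zero] at h
  refine h.congr' ?_
  filter_upwards [eventually_gt_atTop 0] with x hx
  have hA := geoA_ge N hN x hx.le
  have h2 : geoA N x ≠ 0 := by linarith
  have hp : (1+x)^(N-1) = (1 + x * geoA N x)/(1+x) := by
    rw [geoA_mul, eq_div_iff (by positivity), ← pow_succ]
    rw [show N - 1 + 1 = N by omega]; ring
  rw [fnK, hp]
  field_simp

lemma fnP_lim (N : ℕ) (hN : 2 ≤ N) : Tendsto (fnP N) atTop (𝓝 0) := by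
  have hN' : (N:ℝ) ≠ 0 := by positivity
  have hu := tendsto_inv_atTop_zero.comp tend_u
  have hA := tendsto_inv_atTop_zero.comp (tend_A N hN)
  have hl : Tendsto (fun x : ℝ => Real.log (x/(1+x))) atTop (𝓝 0) := by
    have := tend_xu.log one_ne_zero
    simpa using this
  have hs : Tendsto (fun x : ℝ => Real.log (1 - ((1+x)⁻¹)^N)) atTop (𝓝 0) := by
    have h0 : Tendsto (fun x : ℝ => 1 - ((1+x)⁻¹)^N) atTop (𝓝 (1 - 0^N)) :=
      tendsto_const_nhds.sub (hu.pow N)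
    rw [zero_pow (by omega), sub_zero] at h0
    have := h0.log one_ne_zero
    simpa using this
  have h : Tendsto (fun x : ℝ => Real.log (x/(1+x)) * fnK N x + (1+x)⁻¹
      - (1/N) * Real.log (1 - ((1+x)⁻¹)^N) - (1+x)⁻¹ * (geoA N x)⁻¹) atTop
      (𝓝 (0 * 1 + 0 - (1/N) * 0 - 0 * 0)) :=
    (((hl.mul (fnK_lim N hN)).add hu).sub (hs.const_mul _)).sub (hu.mul hA)
  simp only [mul_zero, zero_mul, add_zero, sub_zero] at h
  refine h.congr' ?_
  filter_upwards [eventually_gt_atTop 0] with x hx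
  have hA := geoA_ge N hN x hx.le
  have h2 : geoA N x ≠ 0 := by linarith
  have h3 := pow_gt N hN x hx
  have hu0 : (1+x) ≠ 0 := by positivity
  rw [fnP_eq N hN x hx, Real.log_div hx.ne' (by positivity)]
  have e : 1 - ((1+x)⁻¹)^N = ((1+x)^N - 1) / (1+x)^N := by
    rw [inv_pow]; field_simp
  rw [e, Real.log_div h3.ne' (by positivity), Real.log_pow, ← geoA_mul]
  have : x / ((1+x) * (x * geoA N x)) = (1+x)⁻¹ * (geoA N x)⁻¹ := by
    field_simp
  rw [this]
  ring

lemma Phi_nonneg (N : ℕ) (hN : 2 ≤ N) (x : ℝ) (hx : 0 < x) : 0 ≤ Phi N x := by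
  have := pow_gt N hN x hx
  unfold Phi
  positivity

/-- Integration of a function of `r^2` with nonneg derivative. -/
lemma int_sq (f f' : ℝ → ℝ) (m : ℝ) (hc : ContinuousAt f 0)
    (hd : ∀ x, 0 < x → HasDerivAt f (f' x) x) (hp : ∀ x, 0 < x → 0 ≤ f' x)
    (hl : Tendsto f atTop (𝓝 m)) :
    IntegrableOn (fun r => f' (r^2) * (2 * r)) (Ioi 0) ∧
    ∫ r in Ioi (0:ℝ), f' (r^2) * (2 * r) = m - f 0 := by
  have h1 : ContinuousWithinAt (fun r : ℝ => f (r^2)) (Ici 0) 0 := by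
    apply ContinuousAt.continuousWithinAt
    exact ContinuousAt.comp (f := fun r : ℝ => r^2) (by simpa using hc) (by fun_prop)
  have h2 : ∀ r ∈ Ioi (0:ℝ), HasDerivAt (fun r : ℝ => f (r^2)) (f' (r^2) * (2 * r)) r := by
    intro r hr
    have := HasDerivAt.comp (h := fun r : ℝ => r^2) r (hd (r^2) (pow_pos hr 2)) (hasDerivAt_pow 2 r)
    simpa [Function.comp_def] using this
  have h3 : ∀ r ∈ Ioi (0:ℝ), 0 ≤ f' (r^2) * (2 * r) := fun r hr =>
    mul_nonneg (hp _ (pow_pos hr 2)) (by linarith [mem_Ioi.1 hr])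
  have h4 : Tendsto (fun r : ℝ => f (r^2)) atTop (𝓝 m) :=
    hl.comp (tendsto_pow_atTop two_ne_zero)
  refine ⟨integrableOn_Ioi_deriv_of_nonneg h1 h2 h3 h4, ?_⟩
  have := integral_Ioi_of_hasDerivAt_of_nonneg h1 h2 h3 h4
  simpa using this

/-- Exact value of the expected logarithmic energy of the zeros of a random elliptic
polynomial mapped to the sphere (formula of Armentano–Beltrán–Shub). -/
theorem expected_log_energy (N : ℕ) (hN : 2 ≤ N) :
    -2*(N:ℝ)^2 * ∫ r in Ioi (0:ℝ),
        r * Real.log (2*r / Real.sqrt (1 + r^2)) * Phi N (r^2) =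
      (1/2 - Real.log 2) * (N:ℝ)^2 - (N:ℝ) * Real.log N / 2
        - (1/2 - Real.log 2) * (N:ℝ) := by
  have hN' : (N:ℝ) ≠ 0 := by positivity
  obtain ⟨i1, e1⟩ := int_sq (fnK N) (Phi N) 1 (fnK_diff N hN 0 le_rfl).continuousAt
    (fnK_deriv N hN) (Phi_nonneg N hN) (fnK_lim N hN)
  obtain ⟨i2, e2⟩ := int_sq (fun x => - fnP N x)
    (fun x => -((Real.log x - Real.log (1+x)) * Phi N x)) (-0) (fnP_cont N hN).neg
    (fun x hx => (fnP_deriv N hN x hx).neg)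
    (fun x hx => by
      have := Phi_nonneg N hN x hx
      have h := Real.log_le_log hx (by linarith : x ≤ 1 + x)
      nlinarith) (fnP_lim N hN).neg
  have key : ∫ r in Ioi (0:ℝ), r * Real.log (2*r / Real.sqrt (1 + r^2)) * Phi N (r^2) =
      ∫ r in Ioi (0:ℝ), (Real.log 2 / 2 * (Phi N (r^2) * (2 * r)) -
        1/4 * (-((Real.log (r^2) - Real.log (1+r^2)) * Phi N (r^2)) * (2 * r))) := by
    refine setIntegral_congr_fun measurableSet_Ioi fun r hr => ?_
    have hr : 0 < r := hr
    have h1 : (0:ℝ) < 1 + r^2 := by positivity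
    rw [Real.log_div (by positivity) (by positivity), Real.log_mul two_ne_zero hr.ne',
      Real.log_sqrt h1.le, Real.log_pow]
    push_cast
    ring
  rw [key, integral_sub (i1.const_mul _) (i2.const_mul _), integral_const_mul,
    integral_const_mul, e1, e2, fnP_zero, fnK_zero N hN]
  field_simp
  ring
end

section
/- Let N ≥ 1 be an integer. Then ∫₀¹ ( t^N/(1−t^N) − 1/(N(1−t)) ) dt = −(1/N)·ψ(1 + 1/N) − (log N + γ)/N. -/
open MeasureTheory Set

open Filter Topology in
lemma digamma_add_one_aux (x : ℝ) (hx : 0 < x) : digamma (x + 1) = digamma x + 1 / x := by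
  have hd : DifferentiableAt ℝ Real.Gamma x :=
    Real.differentiableAt_Gamma (fun m => by have : (0:ℝ) ≤ m := m.cast_nonneg; linarith)
  have hG := Real.Gamma_pos_of_pos hx
  have h1 : deriv Real.Gamma (x + 1) = Real.Gamma x + x * deriv Real.Gamma x := by
    rw [← deriv_comp_add_const]
    have he : (fun y : ℝ => Real.Gamma (y + 1)) =ᶠ[𝓝 x] fun y => y * Real.Gamma y := by
      filter_upwards [lt_mem_nhds hx] with y hy
      exact Real.Gamma_add_one hy.ne'
    rw [he.deriv_eq]
    have : HasDerivAt (fun y => y * Real.Gamma y) _ x := (hasDerivAt_id' x).mul hd.hasDerivAt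
    simpa using this.deriv
  unfold digamma
  rw [h1, Real.Gamma_add_one hx.ne']
  field_simp
  ring

lemma digamma_bounds_aux (x : ℝ) (hx : 0 < x) :
    digamma x ≤ Real.log x ∧ Real.log x ≤ digamma (x + 1) := by
  have hc := Real.convexOn_log_Gamma
  have hder : ∀ y : ℝ, 0 < y → HasDerivAt (Real.log ∘ Real.Gamma) (digamma y) y := by
    intro y hy
    have hd : DifferentiableAt ℝ Real.Gamma y :=
      Real.differentiableAt_Gamma (fun m => by have : (0:ℝ) ≤ m := m.cast_nonneg; linarith)
    exact hd.hasDerivAt.log (Real.Gamma_pos_of_pos hy).ne'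
  have hs : slope (Real.log ∘ Real.Gamma) x (x + 1) = Real.log x := by
    rw [slope_def_field]
    simp only [Function.comp]
    rw [Real.Gamma_add_one hx.ne', Real.log_mul hx.ne' (Real.Gamma_pos_of_pos hx).ne']
    simp
  have hx1 : 0 < x + 1 := by linarith
  constructor
  · rw [← hs]
    exact hc.le_slope_of_hasDerivAt (Set.mem_Ioi.2 hx) (Set.mem_Ioi.2 hx1) (by linarith) (hder x hx)
  · rw [← hs]
    exact hc.slope_le_of_hasDerivAt (Set.mem_Ioi.2 hx) (Set.mem_Ioi.2 hx1) (by linarith) (hder _ hx1)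

lemma digamma_add_nat_aux (x : ℝ) (hx : 0 < x) (M : ℕ) :
    digamma (x + M) = digamma x + ∑ k ∈ Finset.range M, 1 / (x + k) := by
  induction M with
  | zero => simp
  | succ m ih =>
    rw [Finset.sum_range_succ, ← add_assoc, ← ih, ← digamma_add_one_aux _ (by positivity)]
    push_cast
    rw [add_assoc]

open Filter Topology in
lemma digamma_lim_aux (x : ℝ) (hx : 0 < x) :
    Tendsto (fun M : ℕ => digamma (x + M) - Real.log M) atTop (𝓝 0) := by
  have h1 : Tendsto (fun M : ℕ => Real.log ((M:ℝ) + x) - Real.log M) atTop (𝓝 0) :=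
    (Real.tendsto_log_comp_add_sub_log x).comp tendsto_natCast_atTop_atTop
  have h3 : Tendsto (fun M : ℕ => (1:ℝ) / ((M:ℝ) + x)) atTop (𝓝 0) :=
    tendsto_const_nhds.div_atTop
      (tendsto_atTop_add_const_right _ _ tendsto_natCast_atTop_atTop)
  have h2 : Tendsto (fun M : ℕ => Real.log ((M:ℝ) + x) - Real.log M - 1 / ((M:ℝ) + x)) atTop (𝓝 0) := by
    simpa using h1.sub h3
  refine tendsto_of_tendsto_of_tendsto_of_le_of_le h2 h1 ?_ ?_
  · intro M
    have hp : 0 < x + M := by positivity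
    have := (digamma_bounds_aux _ hp).2
    rw [digamma_add_one_aux _ hp] at this
    simp only [add_comm (M:ℝ) x]
    linarith
  · intro M
    have hp : 0 < x + M := by positivity
    have := (digamma_bounds_aux _ hp).1
    simp only [add_comm (M:ℝ) x]
    linarith

lemma integrand_bound_aux (N : ℕ) (hN : 1 ≤ N) (t : ℝ) (h0 : 0 < t) (h1 : t < 1) :
    |t^N / (1 - t^N) - 1 / (N * (1 - t))| ≤ 1 := by
  have hNpos : (0:ℝ) < N := by exact_mod_cast hN
  have hS : 1 - t^N = (1 - t) * ∑ i ∈ Finset.range N, t^i := (mul_neg_geom_sum t N).symm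
  set S := ∑ i ∈ Finset.range N, t^i with hSdef
  have hSpos : 0 < S := Finset.sum_pos (fun i _ => by positivity) ⟨0, by simp; omega⟩
  have ht : 0 < 1 - t := by linarith
  have e : t^N / (1 - t^N) - 1 / (N * (1 - t)) = (N * t^N - S) / (N * (1 - t) * S) := by
    rw [hS]; field_simp
  have hN' : (N:ℝ) * t^N = ∑ i ∈ Finset.range N, t^N := by simp
  have hle : (N:ℝ) * t^N ≤ S := by
    rw [hN']
    refine Finset.sum_le_sum fun i hi => ?_
    exact pow_le_pow_of_le_one h0.le h1.le (Finset.mem_range.1 hi).le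
  have hge : S - N * t^N ≤ N * (1 - t) * S := by
    rw [hN', hSdef, ← Finset.sum_sub_distrib, Finset.mul_sum]
    refine Finset.sum_le_sum fun i hi => ?_
    obtain ⟨k, hk⟩ := Nat.exists_eq_add_of_le (Finset.mem_range.1 hi).le
    have hb := one_add_mul_le_pow (a := t - 1) (by linarith) k
    have hkN : (k:ℝ) ≤ N := by exact_mod_cast (by omega : k ≤ N)
    have e2 : t^N = t^i * t^k := by rw [← pow_add, ← hk]
    have e3 : (1 + (t - 1))^k = t^k := by ring_nf
    rw [e3] at hb
    rw [e2]
    have hti : 0 < t^i := by positivity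
    have : 1 - t^k ≤ N * (1 - t) := by nlinarith
    nlinarith
  have hD : 0 < N * (1 - t) * S := by positivity
  rw [e, abs_div, abs_of_pos hD, div_le_one hD, abs_le]
  constructor <;> linarith

open Filter Topology in
theorem integral_lim_aux (N : ℕ) (hN : 1 ≤ N) :
    Tendsto (fun M : ℕ => ∫ t in Ioo (0:ℝ) 1,
        (t^N / (1 - t^N) - 1 / (N * (1 - t))) * (1 - t^(N * M))) atTop
      (𝓝 (∫ t in Ioo (0:ℝ) 1, (t^N / (1 - t^N) - 1 / (N * (1 - t))))) := by
  refine tendsto_integral_of_dominated_convergence (fun _ => (1:ℝ)) ?_ ?_ ?_ ?_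
  · intro M
    exact Measurable.aestronglyMeasurable (by fun_prop)
  · simp
  · intro M
    filter_upwards [ae_restrict_mem measurableSet_Ioo] with t ht
    rw [Real.norm_eq_abs, abs_mul]
    have hp : 0 ≤ t^(N*M) := pow_nonneg ht.1.le _
    have hp1 : t^(N*M) ≤ 1 := pow_le_one₀ ht.1.le ht.2.le
    exact mul_le_one₀ (integrand_bound_aux N hN t ht.1 ht.2) (abs_nonneg _)
      (abs_le.2 ⟨by linarith, by linarith⟩)
  · filter_upwards [ae_restrict_mem measurableSet_Ioo] with t ht
    have h : Tendsto (fun M : ℕ => t^(N*M)) atTop (𝓝 0) := by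
      simp only [pow_mul]
      exact tendsto_pow_atTop_nhds_zero_of_lt_one (pow_nonneg ht.1.le _)
        (pow_lt_one₀ ht.1.le ht.2 (by omega))
    simpa using (h.const_sub 1).const_mul (t^N / (1 - t^N) - 1 / (N * (1 - t)))

theorem integral_partial_aux (N : ℕ) (hN : 1 ≤ N) (M : ℕ) :
    ∫ t in Ioo (0:ℝ) 1, (t^N / (1 - t^N) - 1 / (N * (1 - t))) * (1 - t^(N * M)) =
      (1 / N) * (∑ k ∈ Finset.range M, 1 / ((1 + 1 / N : ℝ) + k) - (harmonic (N * M) : ℝ)) := by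
  have hNpos : (0:ℝ) < N := by exact_mod_cast hN
  have e : ∀ t ∈ Ioo (0:ℝ) 1, (t^N / (1 - t^N) - 1 / (N * (1 - t))) * (1 - t^(N * M)) =
      (∑ k ∈ Finset.range M, t^(N * (k + 1))) - (1 / N) * ∑ j ∈ Finset.range (N * M), t^j := by
    intro t ht
    have h1 : 1 - t ≠ 0 := by linarith [ht.2]
    have h2 : 1 - t^N ≠ 0 := by
      have := pow_lt_one₀ ht.1.le ht.2 (by omega : N ≠ 0)
      linarith
    have a1 : (1 - t) * ∑ j ∈ Finset.range (N * M), t^j = 1 - t^(N*M) := mul_neg_geom_sum t _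
    have a2 : (1 - t^N) * ∑ j ∈ Finset.range M, (t^N)^j = 1 - t^(N*M) := by
      rw [mul_neg_geom_sum, pow_mul]
    have a3 : ∑ k ∈ Finset.range M, t^(N * (k + 1)) = t^N * ∑ j ∈ Finset.range M, (t^N)^j := by
      rw [Finset.mul_sum]
      refine Finset.sum_congr rfl fun k _ => ?_
      rw [pow_mul, pow_succ']
    rw [a3, sub_mul]
    congr 1
    · rw [← a2]; field_simp
    · rw [← a1]; field_simp
  rw [setIntegral_congr_fun measurableSet_Ioo e, ← integral_Ioc_eq_integral_Ioo,
    ← intervalIntegral.integral_of_le zero_le_one, intervalIntegral.integral_sub,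
    intervalIntegral.integral_const_mul, intervalIntegral.integral_finsetSum,
    intervalIntegral.integral_finsetSum, mul_sub]
  · simp only [integral_pow]
    congr 1
    · rw [Finset.mul_sum]
      refine Finset.sum_congr rfl fun k _ => ?_
      push_cast
      have : (0:ℝ) ≤ k := k.cast_nonneg
      simp
      field_simp
      ring
    · simp [harmonic]
  · intro i _; exact (by fun_prop : Continuous fun t : ℝ => t^i).intervalIntegrable _ _
  · intro i _; exact (by fun_prop : Continuous fun t : ℝ => t^(N*(i+1))).intervalIntegrable _ _
  · exact Continuous.intervalIntegrable (by fun_prop) _ _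
  · exact Continuous.intervalIntegrable (by fun_prop) _ _

/-- `∫₀¹ ( t^N/(1−t^N) − 1/(N(1−t)) ) dt = −(1/N)ψ(1+1/N) − (log N + γ)/N`. -/
theorem integral_I4_formula (N : ℕ) (hN : 1 ≤ N) :
    ∫ t in Ioo (0:ℝ) 1, (t^N / (1 - t^N) - 1 / (N * (1 - t))) =
      -(1/N) * digamma (1 + 1/N) - (Real.log N + Real.eulerMascheroniConstant) / N := by
  have hNpos : (0:ℝ) < N := by exact_mod_cast hN
  have hx : (0:ℝ) < 1 + 1 / N := by positivity
  refine tendsto_nhds_unique (integral_lim_aux N hN) ?_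
  have hh : Filter.Tendsto (fun M : ℕ => (harmonic (N * M) : ℝ) - Real.log ((N * M : ℕ) : ℝ))
      Filter.atTop (nhds Real.eulerMascheroniConstant) :=
    Real.tendsto_harmonic_sub_log.comp (Filter.tendsto_id.const_mul_atTop' (by omega : 0 < N))
  have hl := (((digamma_lim_aux _ hx).sub hh).sub_const
    (digamma (1 + 1 / N) + Real.log N)).const_mul (1 / (N:ℝ))
  have hv : -(1/N) * digamma (1 + 1/N) - (Real.log N + Real.eulerMascheroniConstant) / N =
      1 / (N:ℝ) * (0 - Real.eulerMascheroniConstant - (digamma (1 + 1 / N) + Real.log N)) := by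
    ring
  rw [hv]
  refine hl.congr' ?_
  filter_upwards [Filter.eventually_ge_atTop 1] with M hM
  have hMpos : (0:ℝ) < M := by exact_mod_cast hM
  rw [integral_partial_aux N hN, digamma_add_nat_aux _ hx, Nat.cast_mul,
    Real.log_mul hNpos.ne' hMpos.ne']
  ring
end
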